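/- arXiv:1205.5774 — 3 statements merged into one kernel-verified Lean document; each statement's English description precedes it below -/
import Mathlib

section
/- Fix an integer m ≥ 1, a dimension d, and a smooth even function φ compactly supported in the open unit ball 𝔹 ⊂ R^d with ∫φ = 1 and ∫ x^α φ(x) dx = 0 for all multiindices α with 1 ≤ |α| ≤ m−1. Define P_j f(x,h) := 2^{dj} ∫ f(x−z) Σ_{k=0}^{m} 2^{kj} ((h·∇)^k φ)(2^j z)/k! dz. Then for every integer 0 ≤ ℓ ≤ m and every multiindex β with ℓ ≤ |β| ≤ m there is a constant C depending only on φ, d, m, and β such that for every f ∈ C^ℓ(𝔹) and every nonnegative integer j, sup_{|x| ≤ 1−2^{−j}, |h| ≤ 2^{−j}} |∂_h^β P_j f(x,h)| ≤ C · 2^{j(|β|−ℓ)} · sup_{|ω|<1, |γ|=ℓ} |∂^γ f(ω)|. -/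
open Metric MeasureTheory
open scoped ENNReal

/-- The mixed partial derivative of `f` (restricted to the open unit ball of
`ℝ^d`) along the coordinate directions `σ 0, …, σ (k-1)`; these are exactly the
mixed partials `∂^α f` with `|α| = k` for `C^k` functions. -/
noncomputable def mixedPartial {d : ℕ} (k : ℕ) (σ : Fin k → Fin d)
    (f : EuclideanSpace ℝ (Fin d) → ℝ) (x : EuclideanSpace ℝ (Fin d)) : ℝ :=
  iteratedFDerivWithin ℝ k f (ball (0 : EuclideanSpace ℝ (Fin d)) 1) x
    (fun i => EuclideanSpace.single (σ i) (1 : ℝ))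

/-- The Littlewood–Paley-type operator
`P_j f(x,h) = 2^{dj} ∫ f(x-z) Σ_{k=0}^m 2^{kj} ((h·∇)^k φ)(2^j z)/k! dz`,
where `(h·∇)^k φ` is the `k`-fold directional derivative of `φ` along `h`. -/
noncomputable def Pj (d m : ℕ) (φ f : EuclideanSpace ℝ (Fin d) → ℝ) (j : ℕ)
    (x h : EuclideanSpace ℝ (Fin d)) : ℝ :=
  (2 : ℝ) ^ (d * j) * ∫ z : EuclideanSpace ℝ (Fin d),
    f (x - z) * ∑ k ∈ Finset.range (m + 1),
      (2 : ℝ) ^ (k * j) *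
        iteratedFDeriv ℝ k φ (((2 : ℝ) ^ j) • z) (fun _ => h) /
          (Nat.factorial k)

/-- The mixed partial derivative `∂_h^β P_j f(x, h)` in the `h` variables,
encoded by a tuple `σ` of coordinate directions with `|β| = b`. -/
noncomputable def PjHDeriv (d m : ℕ) (φ f : EuclideanSpace ℝ (Fin d) → ℝ)
    (j : ℕ) (x : EuclideanSpace ℝ (Fin d)) (b : ℕ) (σ : Fin b → Fin d)
    (h : EuclideanSpace ℝ (Fin d)) : ℝ :=
  iteratedFDeriv ℝ b (fun h' => Pj d m φ f j x h') h
    (fun i => EuclideanSpace.single (σ i) (1 : ℝ))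

lemma aux_integrable {d : ℕ} {G : Type*} [NormedAddCommGroup G] [NormedSpace ℝ G]
    (U : Set (EuclideanSpace ℝ (Fin d))) (hU : IsOpen U)
    (g : EuclideanSpace ℝ (Fin d) → ℝ) (hg : ContinuousOn g U)
    (ψ : EuclideanSpace ℝ (Fin d) → G) (hψ : Continuous ψ) (hc : HasCompactSupport ψ)
    (hs : tsupport ψ ⊆ U) : Integrable (fun z => g z • ψ z) := by
  have hcs : HasCompactSupport (fun z => g z • ψ z) := hc.smul_left (f := g)
  refine Continuous.integrable_of_hasCompactSupport ?_ hcs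
  refine ContinuousOn.continuous_of_tsupport_subset (hg.smul hψ.continuousOn) hU ?_
  exact (tsupport_smul_subset_right g ψ).trans hs

lemma aux_ibp {d : ℕ} (x v : EuclideanSpace ℝ (Fin d))
    (f : EuclideanSpace ℝ (Fin d) → ℝ) (hf : ContDiffOn ℝ 1 f (ball 0 1))
    (ψ : EuclideanSpace ℝ (Fin d) → ℝ) (hψ : ContDiff ℝ 1 ψ) (hc : HasCompactSupport ψ)
    (hs : tsupport ψ ⊆ (fun z => x - z) ⁻¹' ball 0 1) :
    ∫ z, f (x - z) * fderiv ℝ ψ z v = ∫ z, fderiv ℝ f (x - z) v * ψ z := by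
  set U := (fun z => x - z) ⁻¹' ball (0 : EuclideanSpace ℝ (Fin d)) 1 with hUdef
  have hU : IsOpen U := isOpen_ball.preimage (by fun_prop)
  have hm : Set.MapsTo (fun z => x - z) U (ball 0 1) := fun z hz => hz
  have hfc : ContinuousOn (fun z => f (x - z)) U :=
    hf.continuousOn.comp (by fun_prop) hm
  have hf'c : ContinuousOn (fun z => fderiv ℝ f (x - z) v) U :=
    ((hf.continuousOn_fderiv_of_isOpen isOpen_ball le_rfl).clm_apply continuousOn_const).comp
      (f := fun z => x - z) (by fun_prop) hm
  have hψ'c : Continuous (fun z => fderiv ℝ ψ z v) :=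
    (hψ.continuous_fderiv (by norm_num)).clm_apply continuous_const
  have key := integral_bilinear_hasLineDerivAt_right_eq_neg_left_of_integrable
    (μ := volume) (f := fun z => f (x - z)) (f' := fun z => -(fderiv ℝ f (x - z) v))
    (g := ψ) (g' := fun z => fderiv ℝ ψ z v) (v := v) (B := ContinuousLinearMap.mul ℝ ℝ)
    (by
      simp only [ContinuousLinearMap.mul_apply', neg_mul]
      exact (aux_integrable U hU _ hf'c ψ hψ.continuous hc hs).neg)
    (by
      exact aux_integrable U hU _ hfc _ hψ'c (hc.fderiv_apply ℝ v)
        ((tsupport_fderiv_apply_subset ℝ v).trans hs))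
    (aux_integrable U hU _ hfc ψ hψ.continuous hc hs)
    (by
      intro z hz
      have h1 : DifferentiableAt ℝ f (x - z) :=
        (hf.differentiableOn (by norm_num)).differentiableAt (isOpen_ball.mem_nhds (hs hz))
      have h2 : HasFDerivAt (fun z => x - z) (-(ContinuousLinearMap.id ℝ _)) z :=
        (hasFDerivAt_id z).const_sub x
      have := (h1.hasFDerivAt.comp z h2).hasLineDerivAt v
      simpa [Function.comp_def] using this)
    (by
      intro z _
      exact ((hψ.differentiable (by norm_num)) z).hasFDerivAt.hasLineDerivAt v)
  simp only [ContinuousLinearMap.mul_apply', neg_mul, integral_neg, neg_neg] at key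
  exact key

lemma aux_iter {d : ℕ} (x : EuclideanSpace ℝ (Fin d)) 
    (ψ : EuclideanSpace ℝ (Fin d) → ℝ) (hψ : ContDiff ℝ (⊤ : ℕ∞) ψ) (hc : HasCompactSupport ψ)
    (hs : tsupport ψ ⊆ (fun z => x - z) ⁻¹' ball 0 1) (n : ℕ) (ℓ : ℕ) :
    ∀ (f : EuclideanSpace ℝ (Fin d) → ℝ), ContDiffOn ℝ ℓ f (ball 0 1) →
    ∀ (w : Fin (n + ℓ) → EuclideanSpace ℝ (Fin d)),
    ∫ z, f (x - z) * iteratedFDeriv ℝ (n + ℓ) ψ z w =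
    ∫ z, iteratedFDeriv ℝ ℓ f (x - z) (fun i => w ⟨ℓ - 1 - i, by omega⟩) *
      iteratedFDeriv ℝ n ψ z (fun i => w ⟨ℓ + i, by omega⟩) := by
  induction ℓ with
  | zero =>
    intro f hf w
    simp
  | succ ℓ ih =>
    intro f hf w
    have hd : ContDiff ℝ 1 (iteratedFDeriv ℝ (n + ℓ) ψ) :=
      hψ.iteratedFDeriv_right (by exact_mod_cast le_top)
    have e1 : ∀ z, iteratedFDeriv ℝ (n + (ℓ + 1)) ψ z w =
        fderiv ℝ (fun y => iteratedFDeriv ℝ (n + ℓ) ψ y (Fin.tail w)) z (w 0) := by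
      intro z
      change iteratedFDeriv ℝ ((n + ℓ) + 1) ψ z w = _
      rw [iteratedFDeriv_succ_apply_left,
        fderiv_continuousMultilinear_apply_const_apply ((hd.differentiable (by norm_num)) z)]
    simp_rw [e1]
    have hsup : tsupport (fun y => iteratedFDeriv ℝ (n + ℓ) ψ y (Fin.tail w)) ⊆ tsupport ψ :=
      (tsupport_comp_subset (g := fun L : ContinuousMultilinearMap ℝ (fun _ : Fin (n+ℓ) => EuclideanSpace ℝ (Fin d)) ℝ => L (Fin.tail w)) rfl _).trans
        (tsupport_iteratedFDeriv_subset _)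
    have hd1 : ContDiff ℝ 1 (fun y => iteratedFDeriv ℝ (n + ℓ) ψ y (Fin.tail w)) :=
      (ContinuousMultilinearMap.apply ℝ (fun _ : Fin (n+ℓ) => EuclideanSpace ℝ (Fin d)) ℝ (Fin.tail w)).contDiff.comp hd
    rw [aux_ibp x (w 0) f (hf.of_le (by push_cast; exact le_add_self)) _ hd1
      (hc.of_isClosed_subset isClosed_closure hsup) (hsup.trans hs)]
    have hf' : ContDiffOn ℝ (ℓ + 1) f (ball 0 1) := by exact_mod_cast hf
    have hfd : ContDiffOn ℝ ℓ (fderiv ℝ f) (ball 0 1) :=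
      hf'.fderiv_of_isOpen isOpen_ball le_rfl
    rw [ih (fun y => fderiv ℝ f y (w 0)) (hfd.clm_apply contDiffOn_const)]
    refine integral_congr_ae (Filter.Eventually.of_forall fun z => ?_)
    dsimp only
    by_cases hz : x - z ∈ ball (0 : EuclideanSpace ℝ (Fin d)) 1
    · congr 1
      · rw [iteratedFDeriv_succ_apply_right]
        have h2 := ContinuousLinearMap.iteratedFDeriv_comp_left
          (ContinuousLinearMap.apply ℝ ℝ (w 0)) (hfd.contDiffAt (isOpen_ball.mem_nhds hz)) (i := ℓ) le_rfl
        have h3 : ((ContinuousLinearMap.apply ℝ ℝ (w 0)) ∘ fderiv ℝ f) = fun y => fderiv ℝ f y (w 0) := by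
          ext y; simp
        rw [h3] at h2
        rw [h2]
        simp only [ContinuousLinearMap.compContinuousMultilinearMap_coe, Function.comp_apply,
          ContinuousLinearMap.apply_apply]
        have a1 : (fun i : Fin ℓ => Fin.tail w (⟨ℓ - 1 - i, by omega⟩ : Fin (n + ℓ))) = Fin.init (fun i : Fin (ℓ + 1) => w (⟨ℓ + 1 - 1 - i, by omega⟩)) := by
          ext1 i
          simp only [Fin.tail, Fin.init]
          congr 1
          ext
          simp
          omega
        have a2 : w 0 = w ⟨ℓ + 1 - 1 - (Fin.last ℓ : Fin (ℓ+1)), by simp⟩ := by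
          congr 1
          ext
          simp
        rw [← a2, ← a1]
      · congr 1
        ext1 i
        simp only [Fin.tail]
        congr 1
        ext
        simp
        omega
    · have h0 : iteratedFDeriv ℝ n ψ z = 0 := by
        by_contra h
        exact hz (hs (tsupport_iteratedFDeriv_subset n (subset_tsupport _ h)))
      simp [h0]

lemma aux_succ {E : Type*} [NormedAddCommGroup E] [NormedSpace ℝ E] (ψ : E → ℝ) (hψ : ContDiff ℝ (⊤ : ℕ∞) ψ) (n : ℕ)
    (z : E) (w : Fin (n + 1) → E) : iteratedFDeriv ℝ (n + 1) ψ z w =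
        fderiv ℝ (fun y => iteratedFDeriv ℝ n ψ y (Fin.tail w)) z (w 0) := by
  have hd : ContDiff ℝ 1 (iteratedFDeriv ℝ n ψ) :=
      hψ.iteratedFDeriv_right (by exact_mod_cast le_top)
  rw [iteratedFDeriv_succ_apply_left,
        fderiv_continuousMultilinear_apply_const_apply ((hd.differentiable (by norm_num)) z)]

lemma aux_swap {E : Type*} [NormedAddCommGroup E] [NormedSpace ℝ E] (ψ : E → ℝ) (hψ : ContDiff ℝ (⊤ : ℕ∞) ψ) (n : ℕ) :
    ∀ (i : Fin n) (z : E) (w : Fin (n + 1) → E),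
    iteratedFDeriv ℝ (n + 1) ψ z (w ∘ Equiv.swap i.castSucc i.succ) =
      iteratedFDeriv ℝ (n + 1) ψ z w := by
  induction n with
  | zero => intro i; exact i.elim0
  | succ n ih =>
    intro i z w
    refine Fin.cases ?_ (fun i => ?_) i
    · have hd : ContDiff ℝ 2 (iteratedFDeriv ℝ n ψ) :=
        (contDiff_infty.1 hψ (2 + n)).iteratedFDeriv_right (by norm_cast)
      have key : ∀ w : Fin (n + 2) → E, iteratedFDeriv ℝ (n + 2) ψ z w =
          fderiv ℝ (fderiv ℝ (fun y => iteratedFDeriv ℝ n ψ y (Fin.tail (Fin.tail w)))) z (w 0) (w 1) := by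
        intro w
        have hd1 : ContDiff ℝ 2 (fun y => iteratedFDeriv ℝ n ψ y (Fin.tail (Fin.tail w))) :=
          (ContinuousMultilinearMap.apply ℝ (fun _ : Fin n => E) ℝ (Fin.tail (Fin.tail w))).contDiff.comp hd
        have hd2 : Differentiable ℝ (fderiv ℝ (fun y => iteratedFDeriv ℝ n ψ y (Fin.tail (Fin.tail w)))) :=
          (hd1.fderiv_right (m := 1) (by norm_num)).differentiable (by norm_num)
        rw [aux_succ ψ hψ]
        simp_rw [aux_succ ψ hψ n]
        rw [fderiv_clm_apply (hd2 z) (differentiableAt_const _)]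
        simp [Fin.tail]
      rw [key, key]
      have t : Fin.tail (Fin.tail (w ∘ Equiv.swap (Fin.castSucc 0) (Fin.succ 0))) = Fin.tail (Fin.tail w) := by
        ext1 j
        simp only [Fin.tail, Function.comp]
        rw [Equiv.swap_apply_of_ne_of_ne]
        · simp [Fin.ext_iff]
        · simp [Fin.ext_iff]
      rw [t]
      have hd1 : ContDiff ℝ 2 (fun y => iteratedFDeriv ℝ n ψ y (Fin.tail (Fin.tail w))) :=
          (ContinuousMultilinearMap.apply ℝ (fun _ : Fin n => E) ℝ (Fin.tail (Fin.tail w))).contDiff.comp hd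
      have hsym : IsSymmSndFDerivAt ℝ (fun y => iteratedFDeriv ℝ n ψ y (Fin.tail (Fin.tail w))) z :=
        hd1.contDiffAt.isSymmSndFDerivAt (by simp)
      have h0 : (w ∘ Equiv.swap (Fin.castSucc 0) (Fin.succ 0)) 0 = w 1 := by
        simp
      have h1 : (w ∘ Equiv.swap (Fin.castSucc 0) (Fin.succ 0)) 1 = w 0 := by
        simp
      rw [h0, h1]
      exact hsym.eq _ _
    · rw [aux_succ ψ hψ, aux_succ ψ hψ]
      have h0 : (w ∘ Equiv.swap (Fin.castSucc i.succ) (Fin.succ i.succ)) 0 = w 0 := by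
        simp only [Function.comp]
        rw [Equiv.swap_apply_of_ne_of_ne]
        · simp [Fin.ext_iff]
        · simp [Fin.ext_iff]
      have t : Fin.tail (w ∘ Equiv.swap (Fin.castSucc i.succ) (Fin.succ i.succ)) =
          Fin.tail w ∘ Equiv.swap i.castSucc i.succ := by
        ext1 j
        simp only [Fin.tail, Function.comp]
        congr 1
        simp only [Equiv.swap_apply_def, Fin.ext_iff]
        split_ifs <;> simp_all
      rw [h0, t]
      simp_rw [ih]

lemma aux_perm {E : Type*} [NormedAddCommGroup E] [NormedSpace ℝ E] (ψ : E → ℝ) (hψ : ContDiff ℝ (⊤ : ℕ∞) ψ) (n : ℕ)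
    (z : E) (w : Fin n → E) (π : Equiv.Perm (Fin n)) :
    iteratedFDeriv ℝ n ψ z (w ∘ π) = iteratedFDeriv ℝ n ψ z w := by
  cases n with
  | zero => congr 1; ext1 i; exact i.elim0
  | succ n =>
    have hπ : π ∈ Submonoid.closure (Set.range fun i : Fin n => Equiv.swap i.castSucc i.succ) := by
      rw [Equiv.Perm.mclosure_swap_castSucc_succ]; trivial
    induction hπ using Submonoid.closure_induction generalizing w with
    | mem π h =>
      obtain ⟨i, rfl⟩ := h
      exact aux_swap ψ hψ n i z w
    | one => rfl
    | mul a b _ _ ha hb =>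
      rw [Equiv.Perm.coe_mul, ← Function.comp_assoc, hb, ha]

lemma aux_hderiv {E : Type*} [NormedAddCommGroup E] [NormedSpace ℝ E] (k b : ℕ)
    (T : ContinuousMultilinearMap ℝ (fun _ : Fin k => E) ℝ)
    (hT : ∀ (w : Fin k → E) (π : Equiv.Perm (Fin k)), T (w ∘ π) = T w) (h : E) (v : Fin b → E) :
    iteratedFDeriv ℝ b (fun h' => T (fun _ => h')) h v =
      (Fintype.card (Fin b ↪ Fin k) : ℝ) * T (fun i => if hi : (i : ℕ) < b then v ⟨i, hi⟩ else h) := by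
  classical
  let L : E →L[ℝ] (Fin k → E) := ContinuousLinearMap.pi (fun _ => ContinuousLinearMap.id ℝ E)
  have e0 : (fun h' => T (fun _ => h')) = T ∘ L := by ext h'; rfl
  rw [e0, L.iteratedFDeriv_comp_right (n := b) (T.contDiff) h le_rfl, T.iteratedFDeriv_eq]
  rw [ContinuousMultilinearMap.compContinuousLinearMap_apply, ContinuousMultilinearMap.iteratedFDeriv,
    _root_.sum_apply]
  rw [Finset.sum_congr rfl (g := fun _ => T (fun i => if hi : (i : ℕ) < b then v ⟨i, hi⟩ else h))]
  · simp [Finset.card_univ]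
  · intro e _
    rw [ContinuousMultilinearMap.iteratedFDerivComponent_apply]
    have hbk : b ≤ k := by simpa using Fintype.card_le_of_embedding e
    obtain ⟨π, hπ⟩ := Equiv.Perm.exists_extending_pair (Fin.castLE hbk) e
      (Fin.castLE_injective hbk) e.injective
    rw [← hT _ π]
    congr 1
    ext1 i
    simp only [Function.comp]
    by_cases hi : (i : ℕ) < b
    · have : π i = e ⟨i, hi⟩ := by rw [← hπ]; rfl
      have hr : π i ∈ Set.range e := ⟨_, this.symm⟩
      rw [dif_pos hr, dif_pos hi]
      refine congrArg v ?_
      rw [Equiv.symm_apply_eq]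
      ext
      simp [this]
    · have hr : π i ∉ Set.range e := by
        rintro ⟨a, ha⟩
        rw [← hπ] at ha
        have := π.injective ha
        apply hi
        rw [← this]
        exact a.2
      rw [dif_neg hr, dif_neg hi]
      rfl

lemma aux_supp {d : ℕ} (φ : EuclideanSpace ℝ (Fin d) → ℝ) (hφsupp : tsupport φ ⊆ ball 0 1)
    (R : ℝ) (hR : 0 < R) (x : EuclideanSpace ℝ (Fin d)) (hx : ‖x‖ ≤ 1 - R⁻¹) :
    tsupport (fun z => φ (R • z)) ⊆ (fun z => x - z) ⁻¹' ball 0 1 := by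
  intro z hz
  have h1 : R • z ∈ tsupport φ :=
    tsupport_comp_subset_preimage (f := fun z => R • z) φ (by fun_prop) hz
  have h2 := hφsupp h1
  rw [mem_ball_zero_iff, norm_smul, Real.norm_of_nonneg hR.le] at h2
  have h3 : ‖z‖ < R⁻¹ := by rw [← one_div, lt_div_iff₀' hR]; exact h2
  simp only [Set.mem_preimage, mem_ball_zero_iff]
  linarith [norm_sub_le x z]

lemma aux_bound {d : ℕ} (φ : EuclideanSpace ℝ (Fin d) → ℝ) (hφ : ContDiff ℝ (⊤ : ℕ∞) φ)
    (hc : HasCompactSupport φ) (hφsupp : tsupport φ ⊆ ball 0 1)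
    (R : ℝ) (hR : 0 < R) (x : EuclideanSpace ℝ (Fin d)) (hx : ‖x‖ ≤ 1 - R⁻¹) (n ℓ : ℕ)
    (f : EuclideanSpace ℝ (Fin d) → ℝ) (hf : ContDiffOn ℝ ℓ f (ball 0 1))
    (M : ℝ) (hM0 : 0 ≤ M) (w : Fin (n + ℓ) → EuclideanSpace ℝ (Fin d))
    (hM : ∀ ω ∈ ball (0 : EuclideanSpace ℝ (Fin d)) 1,
      |iteratedFDeriv ℝ ℓ f ω (fun i => w ⟨ℓ - 1 - i, by omega⟩)| ≤ M) :
    |∫ z, f (x - z) * iteratedFDeriv ℝ (n + ℓ) (fun z => φ (R • z)) z w| ≤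
      M * (R ^ n * ((R ^ d)⁻¹ * ∫ z, ‖iteratedFDeriv ℝ n φ z‖)) *
        ∏ i : Fin n, ‖w ⟨ℓ + i, by omega⟩‖ := by
  have hs := aux_supp φ hφsupp R hR x hx
  have hψ : ContDiff ℝ (⊤ : ℕ∞) (fun z => φ (R • z)) := hφ.comp (contDiff_const_smul R)
  have hcψ : HasCompactSupport (fun z => φ (R • z)) := hc.comp_smul hR.ne'
  rw [aux_iter x _ hψ hcψ hs n ℓ f hf w]
  have hD : iteratedFDeriv ℝ n (fun z => φ (R • z)) = _ :=
    iteratedFDeriv_comp_const_smul R (hφ.of_le (by exact_mod_cast le_top))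
  have hint : Integrable (fun z => ‖iteratedFDeriv ℝ n (fun z => φ (R • z)) z‖) := by
    refine (Continuous.integrable_of_hasCompactSupport ?_ (hcψ.iteratedFDeriv n)).norm
    exact hψ.continuous_iteratedFDeriv (by exact_mod_cast le_top)
  have hval : ∫ z, ‖iteratedFDeriv ℝ n (fun z => φ (R • z)) z‖ =
      R ^ n * ((R ^ d)⁻¹ * ∫ z, ‖iteratedFDeriv ℝ n φ z‖) := by
    rw [hD]
    simp only [norm_smul, norm_pow, Real.norm_of_nonneg hR.le]
    rw [integral_const_mul, Measure.integral_comp_smul volume (fun z => ‖iteratedFDeriv ℝ n φ z‖) R]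
    simp [abs_of_pos hR]
  set P := ∏ i : Fin n, ‖w ⟨ℓ + i, by omega⟩‖ with hP
  calc _ ≤ ∫ z, M * ‖iteratedFDeriv ℝ n (fun z => φ (R • z)) z‖ * P := by
        rw [← Real.norm_eq_abs]
        refine norm_integral_le_of_norm_le ((hint.const_mul M).mul_const P)
          (Filter.Eventually.of_forall fun z => ?_)
        by_cases hz : x - z ∈ ball (0 : EuclideanSpace ℝ (Fin d)) 1
        · rw [norm_mul, mul_assoc]
          exact mul_le_mul (hM _ hz) (ContinuousMultilinearMap.le_opNorm _ _) (norm_nonneg _) hM0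
        · have h0 : iteratedFDeriv ℝ n (fun z => φ (R • z)) z = 0 := by
            by_contra h
            exact hz (hs (tsupport_iteratedFDeriv_subset n (subset_tsupport _ h)))
          simp [h0]
    _ = _ := by rw [integral_mul_const, integral_const_mul, hval]

lemma aux_prod {E : Type*} [NormedAddCommGroup E] (R : ℝ) (hR : 1 ≤ R) (h : E) (hh : ‖h‖ ≤ R⁻¹) (n a : ℕ)
    (w : Fin n → E) (h1 : ∀ i : Fin n, (i : ℕ) < a → ‖w i‖ ≤ 1)
    (h2 : ∀ i : Fin n, ¬ (i : ℕ) < a → w i = h) :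
    R ^ n * ∏ i, ‖w i‖ ≤ R ^ a := by
  have e : R ^ n * ∏ i, ‖w i‖ = ∏ i, (R * ‖w i‖) := by
    rw [Finset.prod_mul_distrib]; simp
  have hR0 : 0 < R := by linarith
  rw [e]
  calc _ ≤ ∏ i : Fin n, (if (i : ℕ) < a then R else 1) := by
        refine Finset.prod_le_prod (fun i _ => by positivity) (fun i _ => ?_)
        split_ifs with hi
        · nlinarith [h1 i hi]
        · rw [h2 i hi]
          calc R * ‖h‖ ≤ R * R⁻¹ := by gcongr
            _ = 1 := mul_inv_cancel₀ hR0.ne'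
    _ = R ^ (Finset.univ.filter (fun i : Fin n => (i : ℕ) < a)).card := by
        rw [Finset.prod_ite]; simp
    _ ≤ R ^ a := by
        refine pow_le_pow_right₀ hR ?_
        have := Finset.card_le_card_of_injOn (s := Finset.univ.filter (fun i : Fin n => (i : ℕ) < a))
          (t := Finset.range a) (fun i => (i : ℕ)) (by intro i hi; simpa using hi)
          (fun i _ j _ hij => Fin.ext hij)
        simpa using this

/-- with `φ` as above, for every `0 ≤ ℓ ≤ m` and every multiindex
`β` (encoded by a tuple `σ` of coordinate directions, `ℓ ≤ |β| ≤ m`) there is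
`C = C(φ, d, m, β)` such that for every `f ∈ C^ℓ(𝔹)` and every `j ≥ 0`,
`sup_{|x| ≤ 1-2^{-j}, |h| ≤ 2^{-j}} |∂_h^β P_j f(x,h)| ≤
   C 2^{j(|β|-ℓ)} sup_{|γ|=ℓ} |∂^γ f|`. -/
theorem statement_12 (d m : ℕ) (hm : 1 ≤ m)
    (φ : EuclideanSpace ℝ (Fin d) → ℝ)
    (hφsmooth : ContDiff ℝ (⊤ : ℕ∞) φ) (hφcpt : HasCompactSupport φ)
    (hφsupp : tsupport φ ⊆ ball 0 1)
    (hφeven : ∀ x, φ (-x) = φ x)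
    (hφint : (∫ x : EuclideanSpace ℝ (Fin d), φ x) = 1)
    (hφmom : ∀ α : Fin d → ℕ, 1 ≤ ∑ i, α i → ∑ i, α i ≤ m - 1 →
      (∫ x : EuclideanSpace ℝ (Fin d), (∏ i, x i ^ α i) * φ x) = 0) :
    ∀ ℓ : ℕ, ℓ ≤ m → ∀ b : ℕ, ℓ ≤ b → b ≤ m → ∀ σ : Fin b → Fin d,
      ∃ C : ℝ, 0 < C ∧
        ∀ f : EuclideanSpace ℝ (Fin d) → ℝ,
          ContDiffOn ℝ (ℓ : ℕ∞) f (ball 0 1) →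
          (∃ B : ℝ, ∀ k : ℕ, k ≤ ℓ → ∀ ω ∈ ball (0 : EuclideanSpace ℝ (Fin d)) 1,
            ∀ τ : Fin k → Fin d, |mixedPartial k τ f ω| ≤ B) →
          ∀ M : ℝ,
            (∀ ω ∈ ball (0 : EuclideanSpace ℝ (Fin d)) 1,
              ∀ γ : Fin ℓ → Fin d, |mixedPartial ℓ γ f ω| ≤ M) →
          ∀ j : ℕ, ∀ x h : EuclideanSpace ℝ (Fin d),
            ‖x‖ ≤ 1 - ((2 : ℝ) ^ j)⁻¹ → ‖h‖ ≤ ((2 : ℝ) ^ j)⁻¹ →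
              |PjHDeriv d m φ f j x b σ h| ≤
                C * ((2 : ℝ) ^ j) ^ (b - ℓ) * M := by
  intro ℓ hℓ b hb hbm σ
  refine ⟨1 + ∑ k ∈ Finset.range (m + 1), (Fintype.card (Fin b ↪ Fin k) : ℝ) *
    ∫ z, ‖iteratedFDeriv ℝ (k - ℓ) φ z‖, ?_, ?_⟩
  · have : 0 ≤ ∑ k ∈ Finset.range (m + 1), (Fintype.card (Fin b ↪ Fin k) : ℝ) *
      ∫ z, ‖iteratedFDeriv ℝ (k - ℓ) φ z‖ :=
      Finset.sum_nonneg fun k _ => mul_nonneg (Nat.cast_nonneg _)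
        (integral_nonneg fun z => norm_nonneg _)
    linarith
  intro f hf _ M hM j x h hx hh
  have hf' : ContDiffOn ℝ ℓ f (ball 0 1) := by exact_mod_cast hf
  have hM0 : 0 ≤ M := (abs_nonneg _).trans
    (hM 0 (mem_ball_self one_pos) (fun i => σ (Fin.castLE hb i)))
  set R : ℝ := (2 : ℝ) ^ j with hRdef
  have hR1 : 1 ≤ R := one_le_pow₀ (by norm_num)
  have hR : 0 < R := by linarith
  have hs := aux_supp φ hφsupp R hR x hx
  have hψ : ContDiff ℝ (⊤ : ℕ∞) (fun z => φ (R • z)) := hφsmooth.comp (contDiff_const_smul R)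
  have hcψ : HasCompactSupport (fun z => φ (R • z)) := hφcpt.comp_smul hR.ne'
  have hfc : ContinuousOn (fun z => f (x - z)) ((fun z => x - z) ⁻¹' ball 0 1) :=
    hf.continuousOn.comp (by fun_prop) (fun z hz => hz)
  have hU : IsOpen ((fun z => x - z) ⁻¹' ball (0 : EuclideanSpace ℝ (Fin d)) 1) :=
    isOpen_ball.preimage (by fun_prop)
  have hint : ∀ k : ℕ, Integrable
      (fun z => f (x - z) • iteratedFDeriv ℝ k (fun z => φ (R • z)) z) := fun k =>
    aux_integrable _ hU _ hfc _ (hψ.continuous_iteratedFDeriv (by exact_mod_cast le_top))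
      (hcψ.iteratedFDeriv k) ((tsupport_iteratedFDeriv_subset k).trans hs)
  let S : (k : ℕ) → ContinuousMultilinearMap ℝ (fun _ : Fin k => EuclideanSpace ℝ (Fin d)) ℝ :=
    fun k => ∫ z, f (x - z) • iteratedFDeriv ℝ k (fun z => φ (R • z)) z
  have hSapp : ∀ k (w : Fin k → EuclideanSpace ℝ (Fin d)),
      S k w = ∫ z, f (x - z) * iteratedFDeriv ℝ k (fun z => φ (R • z)) z w := by
    intro k w
    exact ContinuousMultilinearMap.integral_apply (hint k) w
  have hSint : ∀ k (w : Fin k → EuclideanSpace ℝ (Fin d)),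
      Integrable (fun z => f (x - z) * iteratedFDeriv ℝ k (fun z => φ (R • z)) z w) := by
    intro k w
    exact (ContinuousMultilinearMap.apply ℝ
      (fun _ : Fin k => EuclideanSpace ℝ (Fin d)) ℝ w).integrable_comp (hint k)
  let T : (k : ℕ) → ContinuousMultilinearMap ℝ (fun _ : Fin k => EuclideanSpace ℝ (Fin d)) ℝ :=
    fun k => (R ^ d / (k.factorial : ℝ)) • S k
  have hTapp : ∀ k (w : Fin k → EuclideanSpace ℝ (Fin d)),
      T k w = R ^ d / (k.factorial : ℝ) * S k w := fun k w => rfl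
  have hTsym : ∀ k (w : Fin k → EuclideanSpace ℝ (Fin d)) (π : Equiv.Perm (Fin k)),
      T k (w ∘ π) = T k w := by
    intro k w π
    rw [hTapp, hTapp, hSapp, hSapp]
    simp_rw [aux_perm _ hψ]
  have hP : (fun h' => Pj d m φ f j x h') =
      fun h' => ∑ k ∈ Finset.range (m + 1), T k (fun _ => h') := by
    ext h'
    simp only [Pj, hTapp, hSapp]
    have e1 : ∀ z, f (x - z) * ∑ k ∈ Finset.range (m + 1), (2 : ℝ) ^ (k * j) *
        iteratedFDeriv ℝ k φ (((2 : ℝ) ^ j) • z) (fun _ => h') / (Nat.factorial k) =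
        ∑ k ∈ Finset.range (m + 1), ((k.factorial : ℝ))⁻¹ *
          (f (x - z) * iteratedFDeriv ℝ k (fun z => φ (R • z)) z (fun _ => h')) := by
      intro z
      rw [Finset.mul_sum]
      refine Finset.sum_congr rfl fun k _ => ?_
      have hD := congrFun (iteratedFDeriv_comp_const_smul (i := k) R
        (hφsmooth.of_le (by exact_mod_cast le_top))) z
      rw [hD]
      simp only [_root_.smul_apply, smul_eq_mul, hRdef]
      rw [← pow_mul, mul_comm j k]
      ring
    simp_rw [e1]
    rw [integral_finsetSum _ (fun k _ => (hSint k _).const_mul _), Finset.mul_sum]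
    refine Finset.sum_congr rfl fun k _ => ?_
    rw [integral_const_mul, hRdef, ← pow_mul, mul_comm j d]
    ring
  have hTcd : ∀ k ∈ Finset.range (m + 1), ContDiffAt ℝ b (fun h' => T k (fun _ => h')) h := by
    intro k _
    exact ((T k).contDiff.comp (contDiff_pi.2 fun _ => contDiff_id)).contDiffAt
  rw [PjHDeriv, hP, iteratedFDeriv_fun_sum_apply hTcd, _root_.sum_apply]
  simp_rw [aux_hderiv _ b (T _) (hTsym _)]
  have hterm : ∀ k ∈ Finset.range (m + 1),
      |(Fintype.card (Fin b ↪ Fin k) : ℝ) * T k (fun i => if hi : (i : ℕ) < b then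
        EuclideanSpace.single (σ ⟨i, hi⟩) (1 : ℝ) else h)| ≤
      ((Fintype.card (Fin b ↪ Fin k) : ℝ) * ∫ z, ‖iteratedFDeriv ℝ (k - ℓ) φ z‖) *
        (R ^ (b - ℓ) * M) := by
    intro k hk
    by_cases hbk : b ≤ k
    swap
    · have : Fintype.card (Fin b ↪ Fin k) = 0 := by
        rw [Fintype.card_eq_zero_iff]
        exact ⟨fun e => hbk (by simpa using Fintype.card_le_of_embedding e)⟩
      simp [this]
    obtain ⟨n, rfl⟩ : ∃ n, k = n + ℓ := ⟨k - ℓ, by omega⟩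
    rw [abs_mul, Nat.abs_cast, mul_assoc]
    refine mul_le_mul_of_nonneg_left ?_ (Nat.cast_nonneg _)
    rw [hTapp, hSapp, Nat.add_sub_cancel, abs_mul]
    set w : Fin (n + ℓ) → EuclideanSpace ℝ (Fin d) := fun i => if hi : (i : ℕ) < b then
        EuclideanSpace.single (σ ⟨i, hi⟩) (1 : ℝ) else h with hw
    have hB := aux_bound φ hφsmooth hφcpt hφsupp R hR x hx n ℓ f hf' M hM0 w (by
      intro ω hω
      have := hM ω hω (fun i => σ ⟨ℓ - 1 - i, by omega⟩)
      rw [mixedPartial, iteratedFDerivWithin_of_isOpen ℓ isOpen_ball hω] at this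
      convert this using 4 with i
      have : ℓ - 1 - (i : ℕ) < b := by omega
      simp [hw, this])
    have hpr := aux_prod R hR1 h hh n (b - ℓ) (fun i : Fin n => w ⟨ℓ + i, by omega⟩)
      (by
        intro i hi
        have : ℓ + (i : ℕ) < b := by omega
        simp [hw, this])
      (by
        intro i hi
        have : ¬ ℓ + (i : ℕ) < b := by omega
        simp only [hw, this, dite_false])
    have hA : 0 ≤ ∫ z, ‖iteratedFDeriv ℝ n φ z‖ := integral_nonneg fun z => norm_nonneg _
    have hfac : |R ^ d / ((n + ℓ).factorial : ℝ)| ≤ R ^ d := by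
      rw [abs_of_nonneg (by positivity)]
      exact div_le_self (by positivity) (by exact_mod_cast Nat.factorial_pos _)
    calc _ ≤ R ^ d * (M * (R ^ n * ((R ^ d)⁻¹ * ∫ z, ‖iteratedFDeriv ℝ n φ z‖)) *
        ∏ i : Fin n, ‖w ⟨ℓ + i, by omega⟩‖) :=
          mul_le_mul hfac hB (abs_nonneg _) (by positivity)
      _ = (M * ∫ z, ‖iteratedFDeriv ℝ n φ z‖) *
          (R ^ n * ∏ i : Fin n, ‖w ⟨ℓ + i, by omega⟩‖) := by
          field_simp
      _ ≤ (M * ∫ z, ‖iteratedFDeriv ℝ n φ z‖) * R ^ (b - ℓ) :=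
          mul_le_mul_of_nonneg_left hpr (by positivity)
      _ = _ := by ring
  refine (Finset.abs_sum_le_sum_abs _ _).trans ((Finset.sum_le_sum hterm).trans ?_)
  rw [← Finset.sum_mul, mul_assoc]
  refine mul_le_mul_of_nonneg_right ?_ (by positivity)
  linarith
end

section
/- Fix an integer m ≥ 1, a dimension d, and a smooth even function φ compactly supported in the open unit ball 𝔹 ⊂ R^d with ∫φ = 1 and ∫ x^α φ(x) dx = 0 for all multiindices α with 1 ≤ |α| ≤ m−1. Define P_j f(x,h) := 2^{dj} ∫ f(x−z) Σ_{k=0}^{m} 2^{kj} ((h·∇)^k φ)(2^j z)/k! dz. Then for every multiindex β with |β| ≤ m there is a constant C depending only on φ, d, m, and β such that for every bounded continuous function f on 𝔹, every nonnegative integer j, every h ∈ R^d, and every x with |x| ≤ 1 − 2^{−j}, |∂_h^β P_j f(x,h)| ≤ C · 2^{j|β|} (1 + (2^j |h|)^{m−|β|}) · sup_{|ω|<1} |f(ω)|. -/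
open Metric MeasureTheory
open scoped ENNReal

theorem aux_diag_bound {E : Type*} [NormedAddCommGroup E] [NormedSpace ℝ E] {k : ℕ} (b : ℕ)
    (T : ContinuousMultilinearMap ℝ (fun _ : Fin k => E) ℝ) (h : E) :
    ‖iteratedFDeriv ℝ b (fun h' => T (fun _ => h')) h‖
      ≤ (Nat.descFactorial k b : ℝ) * ‖T‖ * ‖h‖ ^ (k - b) := by
  let L : E →L[ℝ] (Fin k → E) := ContinuousLinearMap.pi (fun _ => ContinuousLinearMap.id ℝ E)
  have hL : ‖L‖ ≤ 1 :=
    ContinuousLinearMap.norm_pi_le_of_le (fun _ => ContinuousLinearMap.norm_id_le) zero_le_one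
  have e : (fun h' => T (fun _ => h')) = T ∘ L := rfl
  have hc : ContDiff ℝ b T := T.contDiff
  rw [e, L.iteratedFDeriv_comp_right hc h le_rfl]
  refine (ContinuousMultilinearMap.norm_compContinuousLinearMap_le _ _).trans ?_
  have h1 := T.norm_iteratedFDeriv_le b (L h)
  rw [Fintype.card_fin] at h1
  have h2 : ‖L h‖ ≤ ‖h‖ := (L.le_opNorm h).trans (by nlinarith [norm_nonneg h])
  have h3 : ∏ _i : Fin b, ‖L‖ ≤ 1 :=
    Finset.prod_le_one (fun _ _ => norm_nonneg _) (fun _ _ => hL)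
  calc _ ≤ ‖iteratedFDeriv ℝ b T (L h)‖ * 1 := by gcongr
    _ ≤ _ := by
      rw [mul_one]
      refine h1.trans ?_
      gcongr

theorem aux_mem {E : Type*} [NormedAddCommGroup E] [NormedSpace ℝ E] {s : Set E}
    (hs : s ⊆ ball 0 1) {j : ℕ} {x z : E} (hx : ‖x‖ ≤ 1 - ((2 : ℝ) ^ j)⁻¹)
    (hz : ((2 : ℝ) ^ j) • z ∈ s) : x - z ∈ ball (0 : E) 1 := by
  have h1 := hs hz
  rw [mem_ball_zero_iff, norm_smul, Real.norm_of_nonneg (by positivity)] at h1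
  rw [mem_ball_zero_iff]
  have hp : (0 : ℝ) < 2 ^ j := by positivity
  have h2 : ‖z‖ < ((2 : ℝ) ^ j)⁻¹ := by
    rw [← one_div, lt_div_iff₀ hp]
    linarith
  linarith [norm_sub_le x z]

theorem aux_continuous {E G : Type*} [NormedAddCommGroup E] [NormedSpace ℝ E]
    [NormedAddCommGroup G] [NormedSpace ℝ G]
    {f : E → ℝ} (hf : ContinuousOn f (ball 0 1)) {D : E → G} (hD : Continuous D)
    (hs : tsupport D ⊆ ball 0 1) {j : ℕ} {x : E} (hx : ‖x‖ ≤ 1 - ((2 : ℝ) ^ j)⁻¹) :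
    Continuous (fun z => f (x - z) • D (((2 : ℝ) ^ j) • z)) := by
  rw [continuous_iff_continuousAt]
  intro z
  by_cases hz : ((2 : ℝ) ^ j) • z ∈ tsupport D
  · have hm := aux_mem hs hx hz
    have h1 : ContinuousAt f (x - z) := hf.continuousAt (isOpen_ball.mem_nhds hm)
    have h2 : ContinuousAt (fun z => f (x - z)) z :=
      ContinuousAt.comp (f := fun z => x - z) h1 (by fun_prop)
    exact h2.smul (by fun_prop)
  · have h1 : ∀ᶠ w in nhds (((2 : ℝ) ^ j) • z), D w = 0 := by
      have := notMem_tsupport_iff_eventuallyEq.1 hz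
      exact this
    have h2 : Filter.Tendsto (fun z : E => ((2 : ℝ) ^ j) • z) (nhds z)
        (nhds (((2 : ℝ) ^ j) • z)) := (continuous_const_smul _).tendsto z
    have h3 := h2.eventually h1
    have h4 : (fun z => f (x - z) • D (((2 : ℝ) ^ j) • z)) =ᶠ[nhds z] fun _ => 0 := by
      filter_upwards [h3] with w hw
      rw [hw, smul_zero]
    exact continuousAt_const.congr h4.symm

theorem aux_compact {E G : Type*} [NormedAddCommGroup E] [NormedSpace ℝ E]
    [NormedAddCommGroup G] [NormedSpace ℝ G]
    (f : E → ℝ) {D : E → G} (hc : HasCompactSupport D) (j : ℕ) (x : E) :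
    HasCompactSupport (fun z => f (x - z) • D (((2 : ℝ) ^ j) • z)) := by
  have h1 : HasCompactSupport (fun z => D (((2 : ℝ) ^ j) • z)) :=
    hc.comp_smul (by positivity)
  exact h1.smul_left (f := fun z => f (x - z))

theorem aux_integral_bound {d : ℕ} {G : Type*} [NormedAddCommGroup G] [NormedSpace ℝ G]
    {f : EuclideanSpace ℝ (Fin d) → ℝ}
    {D : EuclideanSpace ℝ (Fin d) → G} (hD : Continuous D) (hc : HasCompactSupport D)
    (hs : tsupport D ⊆ ball 0 1) {j : ℕ} {x : EuclideanSpace ℝ (Fin d)}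
    (hx : ‖x‖ ≤ 1 - ((2 : ℝ) ^ j)⁻¹) {M : ℝ}
    (hM : ∀ ω ∈ ball (0 : EuclideanSpace ℝ (Fin d)) 1, |f ω| ≤ M) :
    (2 : ℝ) ^ (d * j) * ‖∫ z, f (x - z) • D (((2 : ℝ) ^ j) • z)‖ ≤ M * ∫ z, ‖D z‖ := by
  have hp : (0 : ℝ) < 2 ^ j := by positivity
  have h1 : ‖∫ z, f (x - z) • D (((2 : ℝ) ^ j) • z)‖ ≤
      ∫ z, M * ‖D (((2 : ℝ) ^ j) • z)‖ := by
    apply norm_integral_le_of_norm_le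
    · apply Integrable.const_mul
      have : Integrable (fun z => D (((2 : ℝ) ^ j) • z)) :=
        Continuous.integrable_of_hasCompactSupport (by fun_prop) (hc.comp_smul hp.ne')
      exact this.norm
    · filter_upwards with z
      rw [norm_smul]
      by_cases hz : ((2 : ℝ) ^ j) • z ∈ tsupport D
      · gcongr
        exact hM _ (aux_mem hs hx hz)
      · rw [image_eq_zero_of_notMem_tsupport hz]; simp
  rw [integral_const_mul, Measure.integral_comp_smul volume (fun z => ‖D z‖), finrank_euclideanSpace_fin,
    abs_of_pos (by positivity), smul_eq_mul] at h1
  calc _ ≤ (2 : ℝ) ^ (d * j) * (M * ((((2 : ℝ) ^ j) ^ d)⁻¹ * ∫ z, ‖D z‖)) := by gcongr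
    _ = _ := by
      rw [mul_comm d j, pow_mul]
      field_simp

theorem aux_pow {t : ℝ} (ht : 0 ≤ t) {n N : ℕ} (h : n ≤ N) : t ^ n ≤ 1 + t ^ N := by
  rcases le_total t 1 with h1 | h1
  · have := pow_le_one₀ (n := n) ht h1
    have := pow_nonneg ht N
    linarith
  · have := pow_le_pow_right₀ h1 h
    linarith

/-- with `φ` as above, for every multiindex `β` with `|β| ≤ m`
(encoded by a tuple `σ` of coordinate directions of length `b = |β|`) there is
`C = C(φ, d, m, β)` such that for every bounded continuous `f` on `𝔹`, every
`j ≥ 0`, every `h`, and every `x` with `|x| ≤ 1 - 2^{-j}`,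
`|∂_h^β P_j f(x,h)| ≤ C 2^{j|β|} (1 + (2^j |h|)^{m-|β|}) sup_{|ω|<1} |f(ω)|`. -/
theorem statement_13 (d m : ℕ) (hm : 1 ≤ m)
    (φ : EuclideanSpace ℝ (Fin d) → ℝ)
    (hφsmooth : ContDiff ℝ (⊤ : ℕ∞) φ) (hφcpt : HasCompactSupport φ)
    (hφsupp : tsupport φ ⊆ ball 0 1)
    (hφeven : ∀ x, φ (-x) = φ x)
    (hφint : (∫ x : EuclideanSpace ℝ (Fin d), φ x) = 1)
    (hφmom : ∀ α : Fin d → ℕ, 1 ≤ ∑ i, α i → ∑ i, α i ≤ m - 1 →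
      (∫ x : EuclideanSpace ℝ (Fin d), (∏ i, x i ^ α i) * φ x) = 0) :
    ∀ b : ℕ, b ≤ m → ∀ σ : Fin b → Fin d,
      ∃ C : ℝ, 0 < C ∧
        ∀ f : EuclideanSpace ℝ (Fin d) → ℝ,
          ContinuousOn f (ball 0 1) →
          ∀ M : ℝ,
            (∀ ω ∈ ball (0 : EuclideanSpace ℝ (Fin d)) 1, |f ω| ≤ M) →
          ∀ j : ℕ, ∀ x h : EuclideanSpace ℝ (Fin d),
            ‖x‖ ≤ 1 - ((2 : ℝ) ^ j)⁻¹ →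
              |PjHDeriv d m φ f j x b σ h| ≤
                C * ((2 : ℝ) ^ j) ^ b *
                  (1 + ((2 : ℝ) ^ j * ‖h‖) ^ (m - b)) * M := by
  intro b hb σ
  set A : ℕ → ℝ := fun k => ∫ z, ‖iteratedFDeriv ℝ k φ z‖ with hA
  have hA0 : ∀ k, 0 ≤ A k := fun k => integral_nonneg (fun _ => norm_nonneg _)
  have hCn : 0 ≤ ∑ k ∈ Finset.range (m + 1), (Nat.descFactorial k b : ℝ) * A k :=
    Finset.sum_nonneg (fun k _ => mul_nonneg (Nat.cast_nonneg _) (hA0 k))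
  refine ⟨1 + ∑ k ∈ Finset.range (m + 1), (Nat.descFactorial k b : ℝ) * A k, by linarith, ?_⟩
  intro f hf M hM j x h hx
  have hp : (0 : ℝ) < 2 ^ j := by positivity
  have hM0 : 0 ≤ M := (abs_nonneg _).trans (hM 0 (by simp))
  have hDc : ∀ k, Continuous (iteratedFDeriv ℝ k φ) := fun k =>
    hφsmooth.continuous_iteratedFDeriv (by exact_mod_cast le_top)
  have hDs : ∀ k, tsupport (iteratedFDeriv ℝ k φ) ⊆ ball 0 1 := fun k =>
    (tsupport_iteratedFDeriv_subset k).trans hφsupp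
  have hDk : ∀ k, HasCompactSupport (iteratedFDeriv ℝ k φ) := fun k => hφcpt.iteratedFDeriv k
  have hint : ∀ k, Integrable (fun z => f (x - z) • iteratedFDeriv ℝ k φ (((2 : ℝ) ^ j) • z)) :=
    fun k => (aux_continuous hf (hDc k) (hDs k) hx).integrable_of_hasCompactSupport
      (aux_compact f (hDk k) j x)
  set I : (k : ℕ) → ContinuousMultilinearMap ℝ (fun _ : Fin k => EuclideanSpace ℝ (Fin d)) ℝ :=
    fun k => ∫ z, f (x - z) • iteratedFDeriv ℝ k φ (((2 : ℝ) ^ j) • z) with hI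
  set T : (k : ℕ) → ContinuousMultilinearMap ℝ (fun _ : Fin k => EuclideanSpace ℝ (Fin d)) ℝ :=
    fun k => ((2 : ℝ) ^ (d * j) * ((2 : ℝ) ^ (k * j) / (Nat.factorial k))) • I k with hT
  have hIapp : ∀ k (h' : EuclideanSpace ℝ (Fin d)), I k (fun _ => h') =
      ∫ z, f (x - z) * iteratedFDeriv ℝ k φ (((2 : ℝ) ^ j) • z) (fun _ => h') := by
    intro k h'
    have := (ContinuousMultilinearMap.apply ℝ
      (fun _ : Fin k => EuclideanSpace ℝ (Fin d)) ℝ (fun _ => h')).integral_comp_comm (hint k)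
    exact this.symm
  have hP : (fun h' => Pj d m φ f j x h') =
      fun h' => ∑ k ∈ Finset.range (m + 1), T k (fun _ => h') := by
    funext h'
    unfold Pj
    have hint' : ∀ k, Integrable (fun z => f (x - z) *
        iteratedFDeriv ℝ k φ (((2 : ℝ) ^ j) • z) (fun _ => h')) := fun k =>
      (ContinuousMultilinearMap.apply ℝ
        (fun _ : Fin k => EuclideanSpace ℝ (Fin d)) ℝ (fun _ => h')).integrable_comp (hint k)
    have e : ∀ z : EuclideanSpace ℝ (Fin d), f (x - z) * ∑ k ∈ Finset.range (m + 1),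
        (2 : ℝ) ^ (k * j) * iteratedFDeriv ℝ k φ (((2 : ℝ) ^ j) • z) (fun _ => h') /
          (Nat.factorial k) = ∑ k ∈ Finset.range (m + 1),
        ((2 : ℝ) ^ (k * j) / (Nat.factorial k)) * (f (x - z) *
          iteratedFDeriv ℝ k φ (((2 : ℝ) ^ j) • z) (fun _ => h')) := by
      intro z
      rw [Finset.mul_sum]
      refine Finset.sum_congr rfl (fun k _ => ?_)
      ring
    simp_rw [e]
    rw [integral_finsetSum _ (fun k _ => (hint' k).const_mul _), Finset.mul_sum]
    refine Finset.sum_congr rfl (fun k _ => ?_)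
    rw [integral_const_mul, ← hIapp, hT]
    simp only [smul_apply, smul_eq_mul]
    ring
  have hTn : ∀ k, ‖T k‖ ≤ (2 : ℝ) ^ (k * j) * (M * A k) := by
    intro k
    have h1 := aux_integral_bound (hDc k) (hDk k) (hDs k) hx hM
    have hfac : (1 : ℝ) ≤ Nat.factorial k := by exact_mod_cast Nat.factorial_pos k
    have h2 : (2 : ℝ) ^ (k * j) / (Nat.factorial k) ≤ (2 : ℝ) ^ (k * j) :=
      div_le_self (by positivity) hfac
    rw [hT]
    simp only
    rw [norm_smul, Real.norm_of_nonneg (by positivity)]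
    calc _ = (2 : ℝ) ^ (k * j) / (Nat.factorial k) * ((2 : ℝ) ^ (d * j) * ‖I k‖) := by ring
      _ ≤ _ := by gcongr
  have hterm : ∀ k ∈ Finset.range (m + 1),
      ‖iteratedFDeriv ℝ b (fun h' => T k (fun _ => h')) h‖ ≤
        ((Nat.descFactorial k b : ℝ) * A k) *
          (((2 : ℝ) ^ j) ^ b * (1 + ((2 : ℝ) ^ j * ‖h‖) ^ (m - b)) * M) := by
    intro k hk
    refine (aux_diag_bound b (T k) h).trans ?_
    rcases lt_or_ge k b with hkb | hkb
    · rw [Nat.descFactorial_of_lt hkb]; simp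
    · have hkm : k - b ≤ m - b := by
        have := Finset.mem_range.1 hk
        omega
      have h3 := aux_pow (t := (2 : ℝ) ^ j * ‖h‖) (by positivity) hkm
      have h4 : (2 : ℝ) ^ (k * j) = ((2 : ℝ) ^ j) ^ b * ((2 : ℝ) ^ j) ^ (k - b) := by
        rw [← pow_add, Nat.add_sub_cancel' hkb, ← pow_mul, mul_comm]
      have hAk := hA0 k
      calc _ ≤ (Nat.descFactorial k b : ℝ) * ((2 : ℝ) ^ (k * j) * (M * A k)) * ‖h‖ ^ (k - b) := by
            gcongr
            exact hTn k
        _ = ((Nat.descFactorial k b : ℝ) * A k) *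
          (((2 : ℝ) ^ j) ^ b * ((2 : ℝ) ^ j * ‖h‖) ^ (k - b) * M) := by
            rw [h4, mul_pow]; ring
        _ ≤ _ := by gcongr
  have hsum : ‖iteratedFDeriv ℝ b (fun h' => Pj d m φ f j x h') h‖ ≤
      (∑ k ∈ Finset.range (m + 1), (Nat.descFactorial k b : ℝ) * A k) *
          (((2 : ℝ) ^ j) ^ b * (1 + ((2 : ℝ) ^ j * ‖h‖) ^ (m - b)) * M) := by
    rw [hP, iteratedFDeriv_fun_sum_apply, Finset.sum_mul]
    · exact norm_sum_le_of_le _ hterm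
    · intro k _
      apply ContDiff.contDiffAt
      exact (T k).contDiff.comp (contDiff_pi.2 (fun _ => contDiff_id))
  have hQ : 0 ≤ ((2 : ℝ) ^ j) ^ b * (1 + ((2 : ℝ) ^ j * ‖h‖) ^ (m - b)) * M := by positivity
  unfold PjHDeriv
  rw [← Real.norm_eq_abs]
  refine (ContinuousMultilinearMap.le_opNorm _ _).trans ?_
  have hprod : ∏ i, ‖(EuclideanSpace.single (σ i) (1 : ℝ) : EuclideanSpace ℝ (Fin d))‖ = 1 := by
    simp
  rw [hprod, mul_one]
  refine hsum.trans ?_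
  nlinarith
end

section
/- Let 𝔹 be the open unit ball in R^d and let Y₁, …, Y_d be C^m vector fields on 𝔹 satisfying ‖Y_i‖_{C^m(𝔹)} ≤ A for each i and inf_{x ∈ 𝔹} |det(Y₁(x), …, Y_d(x))| ≥ c > 0. Let M ≤ m be a positive integer and suppose f ∈ C^m(𝔹) is of polynomial type with respect to Y₁,…,Y_d of order M, meaning Y_{i₁} ⋯ Y_{i_M} f ≡ 0 on 𝔹 for all (i₁,…,i_M) ∈ {1,…,d}^M. Then there exists ε ∈ (0,1] depending only on d, m, M, A, and c such that sup_{|ω|<1, |α|=M} ε^{|α|} |∂^α f(ω)| ≤ sup_{|ω|<1, 0 ≤ |α| < M} ε^{|α|} |∂^α f(ω)|. -/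
open Metric
open scoped ENNReal

/-- `sup_{|ω|<1, |α| = k} |∂^α f(ω)|`, as an extended nonnegative real. -/
noncomputable def derivSup (d k : ℕ) (f : EuclideanSpace ℝ (Fin d) → ℝ) : ℝ≥0∞ :=
  ⨆ ω ∈ ball (0 : EuclideanSpace ℝ (Fin d)) 1, ⨆ σ : Fin k → Fin d,
    ENNReal.ofReal |mixedPartial k σ f ω|

/-- Iterated application `Y_{σ 0} (Y_{σ 1} ⋯ (Y_{σ (k-1)} f))` of the vector
fields `Y i` (acting by directional differentiation on the unit ball) to `f`. -/
noncomputable def vfIter {d : ℕ}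
    (Y : Fin d → EuclideanSpace ℝ (Fin d) → EuclideanSpace ℝ (Fin d)) :
    (k : ℕ) → (Fin k → Fin d) → (EuclideanSpace ℝ (Fin d) → ℝ) →
      EuclideanSpace ℝ (Fin d) → ℝ
  | 0, _, g => g
  | (k + 1), σ, g => fun x =>
      fderivWithin ℝ (vfIter Y k (fun i => σ i.succ) g)
        (ball (0 : EuclideanSpace ℝ (Fin d)) 1) x (Y (σ 0) x)

section Aux
set_option maxSynthPendingDepth 3

abbrev Esp (d : ℕ) := EuclideanSpace ℝ (Fin d)

def CB {d : ℕ} {F : Type*} [NormedAddCommGroup F] [NormedSpace ℝ F] (n : ℕ) (C : ℝ)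
    (g : Esp d → F) : Prop :=
  ContDiffOn ℝ (n : ℕ∞) g (ball 0 1) ∧
    ∀ k : ℕ, k ≤ n → ∀ x ∈ ball (0 : Esp d) 1,
      ‖iteratedFDerivWithin ℝ k g (ball 0 1) x‖ ≤ C

section
variable {d : ℕ} {F G H : Type*} [NormedAddCommGroup F] [NormedSpace ℝ F]
  [NormedAddCommGroup G] [NormedSpace ℝ G] [NormedAddCommGroup H] [NormedSpace ℝ H]

lemma udo (d : ℕ) : UniqueDiffOn ℝ (ball (0 : Esp d) 1) := isOpen_ball.uniqueDiffOn

lemma CB.mono {n n' : ℕ} {C C' : ℝ} {g : Esp d → F} (h : CB n C g) (hn : n' ≤ n)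
    (hC : C ≤ C') : CB n' C' g :=
  ⟨h.1.of_le (by exact_mod_cast hn), fun k hk x hx => (h.2 k (hk.trans hn) x hx).trans hC⟩

lemma CB.add {n : ℕ} {C C' : ℝ} {g g' : Esp d → F} (h : CB n C g) (h' : CB n C' g') :
    CB n (C + C') (fun x => g x + g' x) := by
  refine ⟨h.1.add h'.1, fun k hk x hx => ?_⟩
  have hk' : (k : WithTop ℕ∞) ≤ ((n : ℕ∞) : WithTop ℕ∞) := by exact_mod_cast hk
  have := fun_iteratedFDerivWithin_add_apply (((h.1 x hx).of_le hk')) ((h'.1 x hx).of_le hk') (udo d) hx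
  rw [this]
  exact (norm_add_le _ _).trans (add_le_add (h.2 k hk x hx) (h'.2 k hk x hx))

lemma CB.fderiv {n : ℕ} {C : ℝ} {g : Esp d → F} (h : CB (n + 1) C g) :
    CB n C (fderivWithin ℝ g (ball 0 1)) := by
  refine ⟨h.1.fderivWithin (udo d) (by norm_cast), fun k hk x hx => ?_⟩
  rw [norm_iteratedFDerivWithin_fderivWithin (udo d) hx]
  exact h.2 (k + 1) (by omega) x hx

lemma CB.clm {n : ℕ} {C : ℝ} {g : Esp d → F} (h : CB n C g) (L : F →L[ℝ] G) (hL : ‖L‖ ≤ 1) :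
    CB n C (fun x => L (g x)) := by
  refine ⟨L.contDiff.comp_contDiffOn h.1, fun k hk x hx => ?_⟩
  have := L.norm_iteratedFDerivWithin_comp_left (h.1 x hx) (udo d) hx
    (n := k) (by exact_mod_cast hk)
  refine this.trans ?_
  calc _ ≤ 1 * C := mul_le_mul hL (h.2 k hk x hx) (norm_nonneg _) zero_le_one
    _ = C := one_mul C

lemma CB.bilin {n : ℕ} {C C' : ℝ} {g : Esp d → F} {g' : Esp d → G} (h : CB n C g)
    (h' : CB n C' g') (B : F →L[ℝ] G →L[ℝ] H) (hB : ‖B‖ ≤ 1) (hC : 0 ≤ C) (hC' : 0 ≤ C') :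
    CB n (2 ^ n * (C * C')) (fun x => B (g x) (g' x)) := by
  refine ⟨B.isBoundedBilinearMap.contDiff.comp_contDiffOn (h.1.prodMk h'.1),
    fun k hk x hx => ?_⟩
  have := B.norm_iteratedFDerivWithin_le_of_bilinear_of_le_one h.1 h'.1 (udo d) hx
    (n := k) (by exact_mod_cast hk) hB
  refine this.trans ?_
  calc _ ≤ ∑ i ∈ Finset.range (k + 1), (k.choose i : ℝ) * (C * C') := by
        refine Finset.sum_le_sum fun i hi => ?_
        have hi' := Finset.mem_range.1 hi
        rw [mul_assoc]
        refine mul_le_mul_of_nonneg_left ?_ (by positivity)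
        exact mul_le_mul (h.2 i (by omega) x hx) (h'.2 _ (by omega) x hx) (norm_nonneg _) hC
    _ = 2 ^ k * (C * C') := by
        rw [← Finset.sum_mul]
        congr 1
        exact_mod_cast Nat.sum_range_choose k
    _ ≤ _ := by
        refine mul_le_mul_of_nonneg_right ?_ (by positivity)
        exact pow_le_pow_right₀ (by norm_num) hk
end

noncomputable def Phi (d j : ℕ) : Esp d →L[ℝ]
    (ContinuousMultilinearMap ℝ (fun _ : Fin (j+1) => Esp d) ℝ) →L[ℝ]
      (ContinuousMultilinearMap ℝ (fun _ : Fin j => Esp d) ℝ) :=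
  ((continuousMultilinearCurryLeftEquiv ℝ (fun _ : Fin (j+1) => Esp d) ℝ).toContinuousLinearEquiv
    : _ →L[ℝ] _).flip

lemma Phi_norm (d j : ℕ) : ‖Phi d j‖ ≤ 1 := by
  unfold Phi
  rw [ContinuousLinearMap.opNorm_flip]
  refine ContinuousLinearMap.opNorm_le_bound _ zero_le_one fun x => ?_
  rw [one_mul]
  exact le_of_eq (LinearIsometryEquiv.norm_map _ x)

lemma Phi_apply (d j : ℕ) (v : Esp d)
    (T : ContinuousMultilinearMap ℝ (fun _ : Fin (j+1) => Esp d) ℝ) (w : Fin j → Esp d) :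
    Phi d j v T w = T (Fin.cons v w) := rfl

lemma Phi_iter (d j : ℕ) (f : Esp d → ℝ) (x v : Esp d) :
    Phi d j v (iteratedFDerivWithin ℝ (j+1) f (ball 0 1) x) =
      fderivWithin ℝ (iteratedFDerivWithin ℝ j f (ball 0 1)) (ball 0 1) x v := by
  ext w
  rw [Phi_apply, iteratedFDerivWithin_succ_apply_left]
  simp

abbrev Bfam (d : ℕ) := (j : ℕ) → Esp d →
  ((ContinuousMultilinearMap ℝ (fun _ : Fin j => Esp d) ℝ) →L[ℝ] ℝ)

noncomputable def nextB {d : ℕ} (B : Bfam d) (V : Esp d → Esp d) : Bfam d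
  | 0 => fun x => fderivWithin ℝ (B 0) (ball 0 1) x (V x)
  | (j + 1) => fun x => fderivWithin ℝ (B (j+1)) (ball 0 1) x (V x) +
      (B j x).comp (Phi d j (V x))

lemma nextB_CB {d n : ℕ} {C A : ℝ} (hC : 0 ≤ C) (hA : 0 ≤ A) {B : Bfam d} {V : Esp d → Esp d}
    (hB : ∀ j, CB (n+1) C (B j)) (hV : CB n A V) (j : ℕ) :
    CB n (2 ^ n * (C * A) + 2 ^ n * (C * A)) (nextB B V j) := by
  have h1 : ∀ j, CB n (2 ^ n * (C * A)) (fun x => fderivWithin ℝ (B j) (ball 0 1) x (V x)) :=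
    fun j => (hB j).fderiv.bilin hV (ContinuousLinearMap.id ℝ _)
      ContinuousLinearMap.norm_id_le hC hA
  have hp : 0 ≤ 2 ^ n * (C * A) := by positivity
  cases j with
  | zero => exact (h1 0).mono le_rfl (by linarith)
  | succ j =>
    refine (h1 (j+1)).add ?_
    exact ((hB j).mono (Nat.le_succ n) le_rfl).bilin (hV.clm (Phi d j) (Phi_norm d j))
      (ContinuousLinearMap.compL ℝ _ _ _) (ContinuousLinearMap.norm_compL_le _ _ _ _) hC hA

lemma key (d m : ℕ) (A : ℝ) (hA : 0 < A) : ∀ k, k ≤ m → ∃ C : ℝ, 0 ≤ C ∧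
    ∀ (Y : Fin d → Esp d → Esp d) (f : Esp d → ℝ), (∀ i, CB m A (Y i)) →
      ContDiffOn ℝ (m : ℕ∞) f (ball 0 1) → ∀ σ : Fin k → Fin d, ∃ B : Bfam d,
        (∀ j, CB (m - k) C (B j)) ∧ (∀ j, k < j → B j = fun _ => 0) ∧
        (∀ x T, B k x T = T (fun i => Y (σ i) x)) ∧
        ∀ x ∈ ball (0 : Esp d) 1, vfIter Y k σ f x =
          ∑ j ∈ Finset.range (k+1), B j x (iteratedFDerivWithin ℝ j f (ball 0 1) x) := by
  intro k
  induction k with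
  | zero =>
    intro _
    let e0 : (ContinuousMultilinearMap ℝ (fun _ : Fin 0 => Esp d) ℝ) →L[ℝ] ℝ :=
      ContinuousMultilinearMap.apply ℝ (fun _ : Fin 0 => Esp d) ℝ 0
    refine ⟨‖e0‖, norm_nonneg _, fun Y f hY hf σ => ?_⟩
    let B : Bfam d := fun j => match j with
      | 0 => fun _ => e0
      | (j+1) => fun _ => 0
    refine ⟨B, ?_, ?_, ?_, ?_⟩
    · have hc : ∀ (F : Type) [NormedAddCommGroup F] [NormedSpace ℝ F] (v : F) (k : ℕ) (x : Esp d),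
          x ∈ ball (0 : Esp d) 1 →
          ‖iteratedFDerivWithin ℝ k (fun _ : Esp d => v) (ball 0 1) x‖ ≤ ‖v‖ := by
        intro F _ _ v k x hx
        cases k with
        | zero => simp
        | succ k => rw [iteratedFDerivWithin_succ_const]; simp
      intro j
      cases j with
      | zero => exact ⟨contDiffOn_const, fun k hk x hx => hc _ _ k x hx⟩
      | succ j => exact ⟨contDiffOn_const, fun k hk x hx => (hc _ _ k x hx).trans (by simp)⟩
    · intro j hj
      cases j with
      | zero => omega
      | succ j => rfl
    · intro x T
      change T 0 = _
      congr 1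
      exact Subsingleton.elim _ _
    · intro x hx
      simp [vfIter, B, e0]
  | succ k ih =>
    intro hk
    obtain ⟨C, hC, H⟩ := ih (by omega)
    refine ⟨2 ^ (m - (k+1)) * (C * A) + 2 ^ (m - (k+1)) * (C * A), by positivity,
      fun Y f hY hf σ => ?_⟩
    obtain ⟨B, hB1, hB2, hB3, hB4⟩ := H Y f hY hf (fun i => σ i.succ)
    have hmk : m - k = (m - (k+1)) + 1 := by omega
    rw [hmk] at hB1
    refine ⟨nextB B (Y (σ 0)), nextB_CB hC hA.le hB1 ((hY _).mono (by omega) le_rfl), ?_, ?_, ?_⟩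
    · intro j hj
      cases j with
      | zero => omega
      | succ j =>
        funext x
        simp [nextB, hB2 (j+1) (by omega), hB2 j (by omega)]
    · intro x T
      simp only [nextB, hB2 (k+1) (by omega)]
      simp only [fderivWithin_fun_const, Pi.zero_apply, zero_apply, zero_add,
        ContinuousLinearMap.comp_apply, hB3, Phi_apply]
      congr 1
      funext i
      refine Fin.cases ?_ (fun i => ?_) i <;> simp
    · intro x hx
      have hdB : ∀ j, DifferentiableWithinAt ℝ (B j) (ball 0 1) x := fun j =>
        ((hB1 j).1.differentiableOn (by simp)) x hx
      have hdf : ∀ j, j ≤ k → DifferentiableWithinAt ℝ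
          (iteratedFDerivWithin ℝ j f (ball 0 1)) (ball 0 1) x := fun j hj =>
        (hf.differentiableOn_iteratedFDerivWithin
          (by exact_mod_cast (show j < m by omega)) (udo d)) x hx
      have hD : HasFDerivWithinAt (vfIter Y k (fun i => σ i.succ) f) _ (ball 0 1) x :=
        (HasFDerivWithinAt.fun_sum (u := Finset.range (k+1)) (fun j hj =>
          (hdB j).hasFDerivWithinAt.clm_apply
            (hdf j (by have := Finset.mem_range.1 hj; omega)).hasFDerivWithinAt)).congr
          hB4 (hB4 x hx)
      rw [vfIter]
      beta_reduce
      rw [hD.fderivWithin (udo d x hx)]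
      rw [Finset.sum_range_succ' _ (k+1)]
      simp only [nextB, ContinuousLinearMap.add_apply, Finset.sum_add_distrib,
        ContinuousLinearMap.comp_apply, Phi_iter, ContinuousLinearMap.sum_apply,
        ContinuousLinearMap.flip_apply]
      rw [add_right_comm, ← Finset.sum_range_succ' (fun j =>
        (fderivWithin ℝ (B j) (ball 0 1) x (Y (σ 0) x))
          (iteratedFDerivWithin ℝ j f (ball 0 1) x)) (k+1), Finset.sum_range_succ _ (k+1)]
      simp [hB2 (k+1) (by omega), add_comm]

lemma expand {d j : ℕ} (T : ContinuousMultilinearMap ℝ (fun _ : Fin j => Esp d) ℝ)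
    (w : Fin j → Esp d) (u : Fin d → Esp d) (q : Fin j → Fin d → ℝ) (K : Fin j → ℝ)
    (hw : ∀ i, w i = ∑ b, q i b • u b) (hq : ∀ i b, |q i b| ≤ K i) :
    |T w| ≤ (∏ i, K i) * ∑ τ : Fin j → Fin d, |T (fun i => u (τ i))| := by
  have h : T w = ∑ τ : Fin j → Fin d, (∏ i, q i (τ i)) * T (fun i => u (τ i)) := by
    rw [funext hw, T.map_sum]
    refine Finset.sum_congr rfl fun τ _ => ?_
    rw [T.map_smul_univ (fun i => q i (τ i)) (fun i => u (τ i)), smul_eq_mul]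
  rw [h, Finset.mul_sum]
  refine (Finset.abs_sum_le_sum_abs _ _).trans (Finset.sum_le_sum fun τ _ => ?_)
  rw [abs_mul, Finset.abs_prod]
  refine mul_le_mul_of_nonneg_right ?_ (abs_nonneg _)
  exact Finset.prod_le_prod (fun i _ => abs_nonneg _) (fun i _ => hq i _)

lemma opnorm_le {d j : ℕ} (T : ContinuousMultilinearMap ℝ (fun _ : Fin j => Esp d) ℝ) :
    ‖T‖ ≤ ∑ τ : Fin j → Fin d, |T (fun i => EuclideanSpace.single (τ i) (1 : ℝ))| := by
  refine T.opNorm_le_bound (Finset.sum_nonneg fun _ _ => abs_nonneg _) fun w => ?_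
  rw [mul_comm]
  refine expand T w (fun b => EuclideanSpace.single b 1) (fun i b => w i b) (fun i => ‖w i‖) ?_ ?_
  · intro i
    ext a
    simp [Pi.single_apply]
  · intro i b
    exact PiLp.norm_apply_le (w i) b

lemma basis_exp {d : ℕ} (A c : ℝ) (hA : 0 < A) (hc : 0 < c) (u : Fin d → Esp d)
    (hu : ∀ b, ‖u b‖ ≤ A) (hdet : c ≤ |(Matrix.of fun a b => u b a).det|) :
    ∃ q : Fin d → Fin d → ℝ, (∀ a, EuclideanSpace.single a (1:ℝ) = ∑ b, q a b • u b) ∧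
      ∀ a b, |q a b| ≤ c⁻¹ * (d.factorial * (max A 1) ^ d) := by
  set P : Matrix (Fin d) (Fin d) ℝ := Matrix.of fun a b => u b a with hP
  have hd0 : P.det ≠ 0 := by
    intro h
    rw [h, abs_zero] at hdet
    linarith
  refine ⟨fun a b => P.det⁻¹ * P.adjugate b a, ?_, ?_⟩
  · intro a
    ext i
    have h1 := congrFun (congrFun P.mul_adjugate i) a
    rw [Matrix.mul_apply] at h1
    have h2 : ∑ b, (P.det⁻¹ * P.adjugate b a) * u b i = P.det⁻¹ * ∑ b, P i b * P.adjugate b a := by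
      rw [Finset.mul_sum]
      refine Finset.sum_congr rfl fun b _ => ?_
      simp only [hP, Matrix.of_apply]
      ring
    simp only [WithLp.ofLp_sum, WithLp.ofLp_smul, Finset.sum_apply, Pi.smul_apply, smul_eq_mul]
    rw [h2, h1]
    simp [Matrix.one_apply, Pi.single_apply, hd0]
  · intro a b
    rw [abs_mul, abs_inv]
    refine mul_le_mul (inv_anti₀ hc hdet) ?_ (abs_nonneg _) (by positivity)
    rw [Matrix.adjugate_apply]
    have := Matrix.det_le (A := P.updateRow a (Pi.single b 1)) (abv := AbsoluteValue.abs)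
      (x := max A 1) ?_
    · simpa using this
    · intro i k
      rw [AbsoluteValue.abs_apply, Matrix.updateRow_apply]
      split_ifs with h
      · rw [Pi.single_apply]
        split_ifs <;> simp
      · exact ((PiLp.norm_apply_le (u k) i).trans (hu k)).trans (le_max_left _ _)

lemma pointwise_bd (d m M : ℕ) (hMm : M ≤ m) (A c : ℝ) (hA : 0 < A) (hc : 0 < c) :
    ∃ K : ℝ, 0 ≤ K ∧
      ∀ (Y : Fin d → Esp d → Esp d) (f : Esp d → ℝ), (∀ i, CB m A (Y i)) →
        (∀ x ∈ ball (0 : Esp d) 1, c ≤ |(Matrix.of fun a b => Y b x a).det|) →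
        ContDiffOn ℝ (m : ℕ∞) f (ball 0 1) →
        (∀ σ : Fin M → Fin d, ∀ x ∈ ball (0 : Esp d) 1, vfIter Y M σ f x = 0) →
        ∀ σ : Fin M → Fin d, ∀ x ∈ ball (0 : Esp d) 1,
          |mixedPartial M σ f x| ≤ K * ∑ j ∈ Finset.range M, ∑ τ : Fin j → Fin d,
            |mixedPartial j τ f x| := by
  obtain ⟨C, hC, H⟩ := key d m A hA M hMm
  set Q : ℝ := c⁻¹ * (d.factorial * (max A 1) ^ d) with hQ
  have hQ0 : 0 ≤ Q := by positivity
  refine ⟨Q ^ M * (d ^ M * C), by positivity, fun Y f hY hdet hf hz σ x hx => ?_⟩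
  set S : ℝ := ∑ j ∈ Finset.range M, ∑ τ : Fin j → Fin d, |mixedPartial j τ f x| with hS
  set T := iteratedFDerivWithin ℝ M f (ball 0 1) x with hT
  have h1 : ∀ τ : Fin M → Fin d, |T (fun i => Y (τ i) x)| ≤ C * S := by
    intro τ
    obtain ⟨B, hB1, -, hB3, hB4⟩ := H Y f hY hf τ
    have h := hB4 x hx
    rw [hz τ x hx, Finset.sum_range_succ, hB3] at h
    have h' : T (fun i => Y (τ i) x) =
        - ∑ j ∈ Finset.range M, B j x (iteratedFDerivWithin ℝ j f (ball 0 1) x) := by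
      rw [hT]; linarith
    rw [h', abs_neg, hS, Finset.mul_sum]
    refine (Finset.abs_sum_le_sum_abs _ _).trans (Finset.sum_le_sum fun j _ => ?_)
    refine ((B j x).le_opNorm _).trans ?_
    refine mul_le_mul ?_ (opnorm_le _) (norm_nonneg _) hC
    have := (hB1 j).2 0 (Nat.zero_le _) x hx
    rwa [norm_iteratedFDerivWithin_zero] at this
  obtain ⟨q, hq1, hq2⟩ := basis_exp A c hA hc (fun b => Y b x) (fun b => by
    have := (hY b).2 0 (Nat.zero_le _) x hx
    rwa [norm_iteratedFDerivWithin_zero] at this) (hdet x hx)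
  have h2 := expand T (fun i => EuclideanSpace.single (σ i) (1:ℝ)) (fun b => Y b x)
    (fun i b => q (σ i) b) (fun _ => Q) (fun i => hq1 _) (fun i b => hq2 _ _)
  have h3 : ∑ τ : Fin M → Fin d, |T (fun i => Y (τ i) x)| ≤ d ^ M * (C * S) := by
    refine (Finset.sum_le_sum fun τ _ => h1 τ).trans ?_
    simp
  calc |mixedPartial M σ f x| ≤ _ := h2
    _ ≤ Q ^ M * (d ^ M * (C * S)) := by
      rw [Finset.prod_const, Finset.card_univ, Fintype.card_fin]
      exact mul_le_mul_of_nonneg_left h3 (by positivity)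
    _ = _ := by ring

lemma le_derivSup {d : ℕ} (k : ℕ) (f : Esp d → ℝ) (τ : Fin k → Fin d) (x : Esp d)
    (hx : x ∈ ball (0 : Esp d) 1) : ENNReal.ofReal |mixedPartial k τ f x| ≤ derivSup d k f :=
  le_trans (le_iSup (fun σ : Fin k → Fin d => ENNReal.ofReal |mixedPartial k σ f x|) τ)
    (le_iSup₂ (f := fun (ω : Esp d) (_ : ω ∈ ball (0 : Esp d) 1) =>
      ⨆ σ : Fin k → Fin d, ENNReal.ofReal |mixedPartial k σ f ω|) x hx)

end Aux

/-- let `Y₁, …, Y_d` be `C^m` vector fields on the unit ball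
with `‖Y_i‖_{C^m} ≤ A` and `inf |det(Y₁,…,Y_d)| ≥ c > 0`.  If `f ∈ C^m(𝔹)`
is of polynomial type of order `M ≤ m` with respect to the `Y_i` (all `M`-fold
iterated `Y`-derivatives of `f` vanish identically on the ball), then there is
`ε ∈ (0,1]` depending only on `d, m, M, A, c` such that
`sup_{|α| = M} ε^{|α|} |∂^α f| ≤ sup_{0 ≤ |α| < M} ε^{|α|} |∂^α f|`. -/
theorem statement_16 (d m M : ℕ) (hM : 1 ≤ M) (hMm : M ≤ m)
    (A c : ℝ) (hA : 0 < A) (hc : 0 < c) :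
    ∃ ε : ℝ, 0 < ε ∧ ε ≤ 1 ∧
      ∀ (Y : Fin d → EuclideanSpace ℝ (Fin d) → EuclideanSpace ℝ (Fin d))
        (f : EuclideanSpace ℝ (Fin d) → ℝ),
        (∀ i, ContDiffOn ℝ (m : ℕ∞) (Y i) (ball 0 1)) →
        (∀ i, ∀ k : ℕ, k ≤ m → ∀ x ∈ ball (0 : EuclideanSpace ℝ (Fin d)) 1,
          ‖iteratedFDerivWithin ℝ k (Y i) (ball 0 1) x‖ ≤ A) →
        (∀ x ∈ ball (0 : EuclideanSpace ℝ (Fin d)) 1,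
          c ≤ |(Matrix.of fun a b => Y b x a).det|) →
        ContDiffOn ℝ (m : ℕ∞) f (ball 0 1) →
        (∀ k ≤ m, derivSup d k f < ⊤) →
        (∀ σ : Fin M → Fin d, ∀ x ∈ ball (0 : EuclideanSpace ℝ (Fin d)) 1,
          vfIter Y M σ f x = 0) →
        ENNReal.ofReal ε ^ M * derivSup d M f ≤
          ⨆ k ∈ Set.Iio M, ENNReal.ofReal ε ^ k * derivSup d k f := by
  obtain ⟨K, hK, H⟩ := pointwise_bd d m M hMm A c hA hc
  set R : ℝ := (K + 1) * (d + 1) ^ M * M with hR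
  have hM' : (1 : ℝ) ≤ M := by exact_mod_cast hM
  have hd' : (1 : ℝ) ≤ (d + 1) ^ M := one_le_pow₀ (by linarith [Nat.cast_nonneg (α := ℝ) d])
  have hR1 : 1 ≤ R := by
    rw [hR]
    exact one_le_mul_of_one_le_of_one_le
      (one_le_mul_of_one_le_of_one_le (by linarith) hd') hM'
  refine ⟨R⁻¹, by positivity, inv_le_one_of_one_le₀ hR1, ?_⟩
  intro Y f hY hYb hdet hf _ hz
  set e : ℝ≥0∞ := ENNReal.ofReal R⁻¹ with he
  have he1 : e ≤ 1 := by
    rw [he, ENNReal.ofReal_le_one]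
    exact inv_le_one_of_one_le₀ hR1
  set S : ℝ≥0∞ := ⨆ k ∈ Set.Iio M, e ^ k * derivSup d k f with hS
  have hmain : derivSup d M f ≤ ENNReal.ofReal ((K + 1) * (d + 1) ^ M) *
      ∑ j ∈ Finset.range M, derivSup d j f := by
    refine iSup₂_le fun x hx => iSup_le fun σ => ?_
    refine (ENNReal.ofReal_le_ofReal
      (H Y f (fun i => ⟨hY i, hYb i⟩) hdet hf hz σ x hx)).trans ?_
    rw [ENNReal.ofReal_mul hK, ENNReal.ofReal_sum_of_nonneg
      (fun j _ => Finset.sum_nonneg fun _ _ => abs_nonneg _),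
      ENNReal.ofReal_mul (by linarith), mul_assoc]
    refine mul_le_mul' (ENNReal.ofReal_le_ofReal (by linarith)) ?_
    rw [Finset.mul_sum]
    refine Finset.sum_le_sum fun j hj => ?_
    rw [ENNReal.ofReal_sum_of_nonneg (fun _ _ => abs_nonneg _)]
    refine (Finset.sum_le_sum fun τ _ => le_derivSup j f τ x hx).trans ?_
    rw [Finset.sum_const, nsmul_eq_mul]
    refine mul_le_mul' ?_ le_rfl
    rw [Finset.card_univ, Fintype.card_fun, Fintype.card_fin, Fintype.card_fin,
      ← ENNReal.ofReal_natCast]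
    refine ENNReal.ofReal_le_ofReal ?_
    push_cast
    have hd0 := Nat.cast_nonneg (α := ℝ) d
    calc (d : ℝ) ^ j ≤ (d + 1) ^ j := pow_le_pow_left₀ hd0 (by linarith) j
      _ ≤ _ := pow_le_pow_right₀ (by linarith) (Finset.mem_range.1 hj).le
  have hterm : ∀ j ∈ Finset.range M, e ^ M * derivSup d j f ≤ e * S := by
    intro j hj
    have hj' := Finset.mem_range.1 hj
    have h1 : e ^ M ≤ e * e ^ j := by
      rw [← pow_succ']
      exact pow_le_pow_right_of_le_one' he1 hj'
    calc e ^ M * derivSup d j f ≤ e * e ^ j * derivSup d j f := mul_le_mul' h1 le_rfl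
      _ = e * (e ^ j * derivSup d j f) := mul_assoc _ _ _
      _ ≤ e * S := mul_le_mul' le_rfl
        (le_iSup₂ (f := fun k (_ : k ∈ Set.Iio M) => e ^ k * derivSup d k f) j hj')
  calc e ^ M * derivSup d M f
      ≤ e ^ M * (ENNReal.ofReal ((K + 1) * (d + 1) ^ M) *
        ∑ j ∈ Finset.range M, derivSup d j f) := mul_le_mul' le_rfl hmain
    _ = ENNReal.ofReal ((K + 1) * (d + 1) ^ M) *
        ∑ j ∈ Finset.range M, e ^ M * derivSup d j f := by
      rw [← Finset.mul_sum]; ring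
    _ ≤ ENNReal.ofReal ((K + 1) * (d + 1) ^ M) * ∑ j ∈ Finset.range M, e * S :=
      mul_le_mul' le_rfl (Finset.sum_le_sum hterm)
    _ = ENNReal.ofReal ((K + 1) * (d + 1) ^ M) * ENNReal.ofReal M * e * S := by
      rw [Finset.sum_const, Finset.card_range, nsmul_eq_mul, ENNReal.ofReal_natCast]
      ring
    _ = S := by
      rw [← ENNReal.ofReal_mul (by positivity), ← hR, he, ← ENNReal.ofReal_mul (by linarith),
        mul_inv_cancel₀ (by linarith), ENNReal.ofReal_one, one_mul]
end
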